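/- Let $G = (V,E)$ be a graph with $n$ vertices and $m$ edges, and let $\pi$ be a uniformly random permutation of $V$. For each vertex $v$, let $q_\pi(v)$ be the total number of recursive calls made when evaluating the recursive lexicographically-first-MIS membership function $f(v, \pi)$ (where $f(v,\pi)$ examines neighbors of $v$ in increasing $\pi$-order and recurses on each neighbor $u$ with $\pi(u) < \pi(v)$ until one returns 1 or all are exhausted). Then $E_\pi\left[\sum_{v \in V} q_\pi(v)\right] \leq m + n$. -/

import Mathlib

open Finset
open scoped Classical

/-- In the greedy-MIS oracle for the ordering `π`, the evaluation of `f π x` recurses on `y`. -/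
def Calls {V : Type*} {n : ℕ} (G : SimpleGraph V) (f : (V ≃ Fin n) → V → Bool)
    (π : V ≃ Fin n) (x y : V) : Prop :=
  G.Adj x y ∧ π y < π x ∧ ∀ w, G.Adj x w → π w < π x → f π w = true → π y ≤ π w

/-- `a t, …, a 1, a 0` is a query path for the ordering `π`, extended to a `(t + 1)`-periodic
sequence, and `σ` is obtained from `π` by rotating the ranks on the path by two steps. -/
structure IsRotatedPath {V : Type*} {n : ℕ} (G : SimpleGraph V) (f : (V ≃ Fin n) → V → Bool)
    (σ π : V ≃ Fin n) (t : ℕ) (a : ℕ → V) : Prop where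
  pos : 1 ≤ t
  calls : ∀ i < t, Calls G f π (a (i + 1)) (a i)
  periodic : Function.Periodic a (t + 1)
  rank_eq : ∀ i, π (a i) = σ (a (i + 2))
  rank_eq_of_notMem : ∀ x, (∀ i, a i ≠ x) → π x = σ x

namespace IsRotatedPath

variable {V : Type*} {n : ℕ} {G : SimpleGraph V} {f : (V ≃ Fin n) → V → Bool}
  {σ π π' : V ≃ Fin n} {t t' : ℕ} {a a' : ℕ → V}

lemma rank_lt (h : IsRotatedPath G f σ π t a) {i j : ℕ} (hij : i < j) (hj : j ≤ t) :
    π (a i) < π (a j) := by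
  induction j, hij using Nat.le_induction with
  | base => exact (h.calls i (by omega)).2.1
  | succ j _ ih => exact (ih (by omega)).trans (h.calls j (by omega)).2.1

lemma rotated_lt (h : IsRotatedPath G f σ π t a) {i j : ℕ} (hi : 2 ≤ i) (hij : i < j)
    (hj : j ≤ t + 2) : σ (a i) < σ (a j) := by
  obtain ⟨i, rfl⟩ := Nat.exists_eq_add_of_le' hi
  obtain ⟨j, rfl⟩ := Nat.exists_eq_add_of_le' (hi.trans hij.le)
  rw [← h.rank_eq, ← h.rank_eq]
  exact h.rank_lt (by omega) (by omega)

lemma rotated_le (h : IsRotatedPath G f σ π t a) {i j : ℕ} (hi : 2 ≤ i) (hij : i ≤ j)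
    (hj : j ≤ t + 2) : σ (a i) ≤ σ (a j) := by
  rcases hij.eq_or_lt with rfl | hij
  · exact le_rfl
  · exact (h.rotated_lt hi hij hj).le

lemma exists_le (h : IsRotatedPath G f σ π t a) (i : ℕ) : ∃ j ≤ t, a i = a j :=
  ⟨i % (t + 1), Nat.lt_succ_iff.1 (Nat.mod_lt _ (by omega)), (h.periodic.map_mod_nat i).symm⟩

lemma ne_of_lt (h : IsRotatedPath G f σ π t a) {i j : ℕ} (hij : i < j) (hj : j ≤ t) :
    a i ≠ a j := fun e => (h.rank_lt hij hj).ne (congrArg π e)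

lemma rotated_last_lt (h : IsRotatedPath G f σ π t a) : σ (a 0) < σ (a 1) := by
  have h0 : a (t + 1) = a 0 := by simpa using h.periodic 0
  have h1 : a (t + 2) = a 1 := by simpa [add_comm, add_left_comm] using h.periodic 1
  rw [← h0, ← h1]
  exact h.rotated_lt (by have := h.pos; omega) (by omega) (by omega)

lemma rank_eq_of_rank_lt (h : IsRotatedPath G f σ π t a) (h' : IsRotatedPath G f σ π' t' a')
    {j : ℕ} (hj : 2 ≤ j) (heq : ∀ i < j, a i = a' i)
    (hlt : σ (a j) < σ (a' j)) {x : V} (hx : π x < σ (a j)) : π' x = π x := by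
  by_cases hxa : ∃ i, a i = x
  · obtain ⟨i, rfl⟩ := hxa
    obtain ⟨i, hi, e⟩ := h.exists_le i
    rw [e] at hx ⊢
    rw [h.rank_eq] at hx ⊢
    have hij : i + 2 < j := by
      by_contra hc
      exact absurd (h.rotated_le hj (not_lt.1 hc) (by omega)) (not_le.2 hx)
    rw [heq i (by omega), h'.rank_eq, heq _ hij]
  · push Not at hxa
    rw [h.rank_eq_of_notMem x hxa] at hx ⊢
    refine h'.rank_eq_of_notMem x fun i hi => ?_
    obtain ⟨i, hit, e⟩ := h'.exists_le i
    subst hi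
    rw [e] at hx hxa
    rcases lt_or_ge i j with hij | hij
    · exact hxa i (heq i hij)
    · exact absurd (hx.trans hlt) (not_lt.2 (h'.rotated_le hj hij (by omega)))

lemma rank_eq_of_rank_lt_symm {r : Fin n} (hr : ∀ x, π x < r → π' x = π x) {x : V}
    (hx : π' x < r) : π x = π' x := by
  obtain ⟨y, hy⟩ := π.surjective (π' x)
  have h := hr y (hy ▸ hx)
  rw [hy] at h
  rwa [π'.injective h] at hy

lemma mis_eq_of_rank_lt
    (hf : ∀ π v, f π v = true ↔ ∀ u, G.Adj v u → π u < π v → f π u = false)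
    {r : Fin n} (hr : ∀ x, π x < r → π' x = π x) (x : V) (hx : π x < r) :
    f π x = f π' x := by
  induction hk : π x using WellFoundedLT.induction generalizing x with
  | ind k ih =>
    subst hk
    rw [Bool.eq_iff_iff, hf, hf]
    refine forall_congr' fun u => forall_congr' fun _ => ?_
    constructor
    · intro H hu
      have hu' : π u < π x := by
        rw [hr x hx] at hu
        rwa [rank_eq_of_rank_lt_symm hr (hu.trans hx)]
      rw [← ih _ hu' u (hu'.trans hx) rfl]
      exact H hu'
    · intro H hu
      rw [ih _ hu u (hu.trans hx) rfl]
      exact H (by rwa [hr x hx, hr u (hu.trans hx)])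

lemma not_rotated_lt
    (hf : ∀ π v, f π v = true ↔ ∀ u, G.Adj v u → π u < π v → f π u = false)
    (h : IsRotatedPath G f σ π t a) (h' : IsRotatedPath G f σ π' t' a')
    {j : ℕ} (hj : 2 ≤ j) (hjt : j ≤ t + 1) (hjt' : j ≤ t' + 1) (heq : ∀ i < j, a i = a' i) :
    ¬ σ (a j) < σ (a' j) := by
  intro hlt
  have hjt : j ≤ t := by
    by_contra hc
    obtain rfl : j = t + 1 := by omega
    have h0 : a (t + 1) = a 0 := by simpa using h.periodic 0
    have h0' : a' (t' + 1) = a' 0 := by simpa using h'.periodic 0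
    rw [h0, heq 0 (by omega), ← h0'] at hlt
    exact absurd (h'.rotated_le hj hjt' (by omega)) (not_le.2 hlt)
  have hagree : ∀ x, π x < σ (a j) → π' x = π x := fun x =>
    h.rank_eq_of_rank_lt h' hj heq hlt
  have hrank : π' (a j) = σ (a j) := by
    refine h'.rank_eq_of_notMem _ fun i hi => ?_
    obtain ⟨i, hit, e⟩ := h'.exists_le i
    rw [e] at hi
    rcases lt_or_ge i j with hij | hij
    · exact h.ne_of_lt hij hjt ((heq i hij).trans hi)
    · exact absurd (hi ▸ hlt) (not_lt.2 (h'.rotated_le hj hij (by omega)))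
  obtain ⟨k, rfl⟩ := Nat.exists_eq_add_of_le' hj
  have hcall := h.calls (k + 1) (by omega)
  have hcall' := h'.calls k (by omega)
  have hmis : f π' (a (k + 2)) = true := by
    rw [hf]
    intro u hadj hu
    rw [hrank] at hu
    have hu' : π u < σ (a (k + 2)) := (rank_eq_of_rank_lt_symm hagree hu).trans_lt hu
    rw [← mis_eq_of_rank_lt hf hagree u hu', ← Bool.not_eq_true]
    intro hfu
    have hlt' : π u < π (a (k + 1)) := by
      rw [h.rank_eq]
      exact hu'.trans (h.rotated_lt hj (by omega) (by omega))
    exact absurd (hcall.2.2 u hadj (hlt'.trans hcall.2.1) hfu) (not_le.2 hlt')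
  have hle := hcall'.2.2 (a (k + 2)) (by rw [← heq (k + 1) (by omega)]; exact hcall.1.symm)
    (by
      rw [hrank, h'.rank_eq]
      exact hlt.trans (h'.rotated_lt hj (by omega) (by omega))) hmis
  rw [hrank, h'.rank_eq] at hle
  exact absurd hlt (not_lt.2 hle)

/-- A query path can be recovered from the rotated ordering and the last edge of the path. -/
lemma unique
    (hf : ∀ π v, f π v = true ↔ ∀ u, G.Adj v u → π u < π v → f π u = false)
    (h : IsRotatedPath G f σ π t a) (h' : IsRotatedPath G f σ π' t' a')
    (he : s(a 0, a 1) = s(a' 0, a' 1)) : t = t' ∧ a = a' ∧ π = π' := by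
  have h01 : a 0 = a' 0 ∧ a 1 = a' 1 := by
    rcases Sym2.eq_iff.1 he with h01 | ⟨e0, e1⟩
    · exact h01
    · have := h.rotated_last_lt
      rw [e0, e1] at this
      exact absurd this h'.rotated_last_lt.asymm
  have heq : ∀ j, j ≤ t + 1 → j ≤ t' + 1 → a j = a' j := by
    intro j
    induction j using Nat.strong_induction_on with
    | _ j ih =>
      intro hjt hjt'
      rcases lt_or_ge j 2 with hj | hj
      · interval_cases j
        exacts [h01.1, h01.2]
      · have hpre : ∀ i < j, a i = a' i := fun i hi => ih i hi (by omega) (by omega)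
        refine σ.injective (le_antisymm (not_lt.1 ?_) (not_lt.1 ?_))
        · exact h'.not_rotated_lt hf h hj hjt' hjt fun i hi => (hpre i hi).symm
        · exact h.not_rotated_lt hf h' hj hjt hjt' hpre
  have h0 : a (t + 1) = a 0 := by simpa using h.periodic 0
  have h0' : a' (t' + 1) = a' 0 := by simpa using h'.periodic 0
  obtain rfl : t = t' := by
    rcases lt_trichotomy t t' with hlt | rfl | hlt
    · refine absurd ?_ (h'.ne_of_lt (Nat.succ_pos t) hlt)
      rw [Nat.succ_eq_add_one, ← heq (t + 1) (by omega) (by omega), h0, h01.1]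
    · rfl
    · refine absurd ?_ (h.ne_of_lt (Nat.succ_pos t') hlt)
      rw [Nat.succ_eq_add_one, heq (t' + 1) (by omega) (by omega), h0', h01.1]
  obtain rfl : a = a' := by
    funext i
    have : i % (t + 1) < t + 1 := Nat.mod_lt _ (by omega)
    rw [← h.periodic.map_mod_nat i, ← h'.periodic.map_mod_nat i]
    exact heq _ (by omega) (by omega)
  refine ⟨rfl, rfl, Equiv.ext fun x => ?_⟩
  by_cases hx : ∃ i, a i = x
  · obtain ⟨i, rfl⟩ := hx
    rw [h.rank_eq, h'.rank_eq]
  · push Not at hx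
    rw [h.rank_eq_of_notMem x hx, h'.rank_eq_of_notMem x hx]

/-- Every query path, listed from its last vertex to its first, can be rotated. -/
lemma exists_of_isChain {M : List V} (hM : M.IsChain fun x y => Calls G f π y x)
    (hlen : 2 ≤ M.length) :
    ∃ σ t a, IsRotatedPath G f σ π t a ∧ M = (List.range (t + 1)).map a := by
  obtain ⟨t, ht⟩ := Nat.exists_eq_add_of_le' (show 1 ≤ M.length by omega)
  have hnodup : M.Nodup := by
    have hlt : M.IsChain fun x y => π x < π y := hM.imp fun x y h => h.2.1
    have : IsTrans V fun x y => π x < π y := ⟨fun _ _ _ => lt_trans⟩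
    exact (List.isChain_iff_pairwise.1 hlt).imp fun h e => h.ne (congrArg π e)
  have hmod : ∀ i, i % (t + 1) < M.length := fun i => ht ▸ Nat.mod_lt _ (by omega)
  let F : Equiv.Perm V := M.formPerm
  let a : ℕ → V := fun i => M[i % (t + 1)]'(hmod i)
  have hF : ∀ i, F (a i) = a (i + 1) := fun i => by
    simp only [F, a, List.formPerm_apply_getElem M hnodup, ht, Nat.mod_add_mod]
  refine ⟨(F * F)⁻¹.trans π, t, a, ⟨by omega, fun i hi => ?_, fun i => ?_, fun i => ?_,
    fun x hx => ?_⟩, ?_⟩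
  · have := List.isChain_iff_getElem.1 hM i (by omega)
    simpa [a, Nat.mod_eq_of_lt (show i < t + 1 by omega),
      Nat.mod_eq_of_lt (show i + 1 < t + 1 by omega)] using this
  · simp [a]
  · have : a (i + 2) = (F * F) (a i) := by simp [hF]
    rw [this, Equiv.trans_apply, Equiv.Perm.inv_eq_iff_eq.2 rfl]
  · have hxM : x ∉ M := fun hmem => by
      obtain ⟨i, hi, rfl⟩ := List.getElem_of_mem hmem
      exact hx i (by simp [a, Nat.mod_eq_of_lt (show i < t + 1 by omega)])
    have : (F * F) x = x := by simp [F, List.formPerm_apply_of_notMem hxM]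
    rw [Equiv.trans_apply, Equiv.Perm.inv_eq_iff_eq.2 this.symm]
  · refine List.ext_getElem (by simp [ht]) fun i h1 h2 => ?_
    simp [a, Nat.mod_eq_of_lt (show i < t + 1 by omega)]

end IsRotatedPath

/-- The query paths starting at a vertex form a finite set counted by the number of calls. -/
lemma exists_finset_queryPaths {V : Type*} [Fintype V] {n : ℕ} {G : SimpleGraph V}
    {f : (V ≃ Fin n) → V → Bool} {π : V ≃ Fin n} {q : V → ℕ}
    (hq : ∀ v, q v = 1 + ∑ u ∈ Finset.univ.filter (Calls G f π v), q u) (v : V) :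
    ∃ S : Finset (List V), S.card = q v ∧
      ∀ M ∈ S, (M.IsChain fun x y => Calls G f π y x) ∧ M.getLast? = some v := by
  induction hk : π v using WellFoundedLT.induction generalizing v with
  | ind k ih =>
    subst hk
    choose! S hcard hS using fun u (hu : π u < π v) => ih (π u) hu u rfl
    let T : Finset (List V) :=
      (univ.filter (Calls G f π v)).biUnion fun u => (S u).image (· ++ [v])
    have hT : T.card = ∑ u ∈ univ.filter (Calls G f π v), q u := by
      rw [Finset.card_biUnion]
      · refine Finset.sum_congr rfl fun u hu => ?_
        rw [Finset.card_image_of_injective _ (List.append_left_injective _),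
          hcard u (Finset.mem_filter.1 hu).2.2.1]
      · intro u hu u' hu' hne
        refine Finset.disjoint_left.2 ?_
        intro M hM hM'
        obtain ⟨L, hL, rfl⟩ := Finset.mem_image.1 hM
        obtain ⟨L', hL', e⟩ := Finset.mem_image.1 hM'
        obtain rfl : L' = L := List.append_left_injective _ e
        have h1 := (hS u (Finset.mem_filter.1 hu).2.2.1 _ hL).2
        have h2 := (hS u' (Finset.mem_filter.1 hu').2.2.1 _ hL').2
        exact hne (Option.some.inj (h1.symm.trans h2))
    have hnot : [v] ∉ T := by
      intro hmem
      obtain ⟨u, hu, hM⟩ := Finset.mem_biUnion.1 hmem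
      obtain ⟨L, hL, e⟩ := Finset.mem_image.1 hM
      have := (hS u (Finset.mem_filter.1 hu).2.2.1 _ hL).2
      obtain rfl : L = [] := by simpa using e
      simp at this
    refine ⟨insert [v] T, by rw [Finset.card_insert_of_notMem hnot, hT, hq v, add_comm], ?_⟩
    intro M hM
    rcases Finset.mem_insert.1 hM with rfl | hM
    · simp
    · obtain ⟨u, hu, hM⟩ := Finset.mem_biUnion.1 hM
      obtain ⟨L, hL, rfl⟩ := Finset.mem_image.1 hM
      have hcall := (Finset.mem_filter.1 hu).2
      obtain ⟨hchain, hlast⟩ := hS u hcall.2.1 _ hL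
      refine ⟨List.isChain_append.2 ⟨hchain, by simp, ?_⟩, by simp⟩
      simpa [hlast] using hcall

/-- Yoshida–Yamamoto–Ito bound: for a uniformly random vertex ordering
`π : V ≃ Fin n`, the expected total number of recursive calls
`∑_v q_π(v)` of the greedy-MIS membership oracle is at most `m + n`.
Here `f π` is the MIS indicator (the lexicographically first MIS w.r.t. `π`),
and `q π v` counts the recursive calls of `f(v,π)`, which recurses on the
lower-ordered neighbors of `v` in increasing `π`-order up to and including the
first one belonging to the MIS. Both are characterized by their defining
recurrences, given as hypotheses. -/
theorem yoshida_expected_queries {V : Type*} [Fintype V]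
    (n : ℕ) (hn : n = Fintype.card V) (G : SimpleGraph V)
    (f : (V ≃ Fin n) → V → Bool)
    (hf : ∀ π v, f π v = true ↔ ∀ u, G.Adj v u → π u < π v → f π u = false)
    (q : (V ≃ Fin n) → V → ℕ)
    (hq : ∀ π v, q π v = 1 +
      ∑ u ∈ Finset.univ.filter (fun u => G.Adj v u ∧ π u < π v ∧
          ∀ w, G.Adj v w → π w < π v → f π w = true → π u ≤ π w),
        q π u) :
    (∑ π : V ≃ Fin n, ∑ v : V, (q π v : ℝ)) / (Nat.factorial n : ℝ)
      ≤ (Nat.card G.edgeSet : ℝ) + (n : ℝ) := by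
  have hq' : ∀ π v, q π v = 1 + ∑ u ∈ Finset.univ.filter (Calls G f π v), q π u := fun π v => by
    rw [hq π v]
    congr!
  choose S hcard hS using fun π => exists_finset_queryPaths (hq' π)
  let T : (V ≃ Fin n) → Finset (List V) := fun π => univ.biUnion (S π)
  have hT : ∀ π, (T π).card = ∑ v, q π v := fun π => by
    rw [Finset.card_biUnion]
    · exact Finset.sum_congr rfl fun v _ => hcard π v
    · intro v _ v' _ hne
      refine Finset.disjoint_left.2 ?_
      intro M hM hM'
      exact hne (Option.some.inj ((hS π v M hM).2.symm.trans (hS π v' M hM').2))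
  let P : (V ≃ Fin n) → Finset (List V) := fun π => (T π).filter fun M => 2 ≤ M.length
  have hTP : ∀ π, (T π).card ≤ (P π).card + n := fun π => by
    rw [← Finset.card_filter_add_card_filter_not (s := T π) fun M => 2 ≤ M.length]
    gcongr
    rw [hn, ← Finset.card_univ]
    refine (Finset.card_le_card ?_).trans
      (Finset.card_image_le (s := (univ : Finset V)) (f := fun v => [v]))
    intro M hM
    obtain ⟨hM, hlen⟩ := Finset.mem_filter.1 hM
    obtain ⟨v, -, hM⟩ := Finset.mem_biUnion.1 hM
    have hlast := (hS π v M hM).2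
    match M, hlen, hlast with
    | [x], _, _ => simp
    | x :: y :: L, hlen, _ => simp at hlen
  have hcount : ∑ π, (P π).card ≤ n.factorial * Nat.card G.edgeSet := by
    have hle : (univ.sigma P).card ≤
        ((univ : Finset (V ≃ Fin n)) ×ˢ G.edgeFinset).card := by
      refine Finset.card_le_card_of_forall_subsingleton
        (fun p e => ∃ t a, IsRotatedPath G f e.1 p.1 t a ∧ p.2 = (List.range (t + 1)).map a ∧
          e.2 = s(a 0, a 1)) ?_ ?_
      · rintro ⟨π, M⟩ hp
        obtain ⟨hM, hlen⟩ := Finset.mem_filter.1 (Finset.mem_sigma.1 hp).2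
        obtain ⟨v, -, hM⟩ := Finset.mem_biUnion.1 hM
        obtain ⟨σ, t, a, h, hMa⟩ := IsRotatedPath.exists_of_isChain (hS π v M hM).1 hlen
        refine ⟨(σ, s(a 0, a 1)), ?_, t, a, h, hMa, rfl⟩
        simpa using (h.calls 0 h.pos).1.symm
      · rintro ⟨σ, e⟩ - ⟨π, M⟩ ⟨-, t, a, h, hM, he⟩ ⟨π', M'⟩ ⟨-, t', a', h', hM', he'⟩
        obtain ⟨rfl, rfl, rfl⟩ := h.unique hf h' (he.symm.trans he')
        simp only at hM hM'
        rw [hM, hM']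
    rwa [Finset.card_sigma, Finset.card_product, Finset.card_univ,
      Fintype.card_equiv (Fintype.equivFinOfCardEq hn.symm), ← hn,
      SimpleGraph.edgeFinset_card, ← Nat.card_eq_fintype_card] at hle
  have htotal : ∑ π, ∑ v, q π v ≤ (Nat.card G.edgeSet + n) * n.factorial := by
    calc ∑ π, ∑ v, q π v ≤ ∑ π, ((P π).card + n) :=
          Finset.sum_le_sum fun π _ => (hT π).symm.trans_le (hTP π)
      _ = ∑ π, (P π).card + n.factorial * n := by
          rw [Finset.sum_add_distrib, Finset.sum_const, Finset.card_univ,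
            Fintype.card_equiv (Fintype.equivFinOfCardEq hn.symm), ← hn, smul_eq_mul]
      _ ≤ (Nat.card G.edgeSet + n) * n.factorial := by
          rw [add_mul, mul_comm n, mul_comm (Nat.card _)]
          gcongr
  rw [div_le_iff₀ (by positivity)]
  exact_mod_cast htotal
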